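/- arXiv:cs/0607132 — 7 statements merged into one kernel-verified Lean document; each statement's English description precedes it below -/
import Mathlib

section
/- Let q ≥ 2, n ≥ 1 and ℓ ≥ 0 be integers and let Q = {0,1,…,q−1}. A code C ⊆ Q^n is an ℓ-AEC code (i.e., for all distinct x, y ∈ C there do not exist e, f ∈ {0,1,…,ℓ}^n with x + e = y + f and x + e ∈ Q^n) if and only if d(x,y) ≥ ℓ + 1 for all distinct x, y ∈ C. -/
open Finset Filter

/-- `x` is a word over the alphabet `Q = {0,1,…,q-1}`. -/
def inQ (q : ℤ) {n : ℕ} (x : Fin n → ℤ) : Prop :=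
  ∀ i, 0 ≤ x i ∧ x i ≤ q - 1

/-- `d(x,y) = max_i |x_i - y_i|`. -/
def dmax {n : ℕ} (x y : Fin n → ℤ) : ℤ :=
  ((Finset.univ.sup fun i => (x i - y i).natAbs : ℕ) : ℤ)

/-- `d_u(x,y)`: equals `d(x,y)` if `x ≥ y` or `y ≥ x`, and `2·d(x,y)` otherwise. -/
def du {n : ℕ} (x y : Fin n → ℤ) : ℤ :=
  if (∀ i, y i ≤ x i) ∨ (∀ i, x i ≤ y i) then dmax x y else 2 * dmax x y

/-- Maximum size of an `ℓ`-AEC code in `Q^n`. -/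
noncomputable def Aa (q : ℤ) (n : ℕ) (ℓ : ℤ) : ℕ :=
  sSup {k : ℕ | ∃ C : Finset (Fin n → ℤ), (∀ x ∈ C, inQ q x) ∧
    (∀ x ∈ C, ∀ y ∈ C, x ≠ y → ℓ + 1 ≤ dmax x y) ∧ C.card = k}

/-- Maximum size of an `ℓ`-UEC code in `Q^n`. -/
noncomputable def Au (q : ℤ) (n : ℕ) (ℓ : ℤ) : ℕ :=
  sSup {k : ℕ | ∃ C : Finset (Fin n → ℤ), (∀ x ∈ C, inQ q x) ∧
    (∀ x ∈ C, ∀ y ∈ C, x ≠ y → 2 * ℓ + 1 ≤ du x y) ∧ C.card = k}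

/-- `C` is a code of Varshamov–Tenengolts type: the solution set in `Q^n`
of a linear equation `Σ aᵢ xᵢ = a` over `ℤ`. -/
def IsVT (q : ℤ) {n : ℕ} (C : Finset (Fin n → ℤ)) : Prop :=
  ∃ (coef : Fin n → ℤ) (a : ℤ),
    ∀ x : Fin n → ℤ, x ∈ C ↔ (inQ q x ∧ ∑ i, coef i * x i = a)

/-- Maximum size of a VT-type `ℓ`-AEC code in `Q^n`. -/
noncomputable def LAa (q : ℤ) (n : ℕ) (ℓ : ℤ) : ℕ :=
  sSup {k : ℕ | ∃ C : Finset (Fin n → ℤ), IsVT q C ∧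
    (∀ x ∈ C, ∀ y ∈ C, x ≠ y → ℓ + 1 ≤ dmax x y) ∧ C.card = k}

/-- Maximum size of a VT-type `ℓ`-UEC code in `Q^n`. -/
noncomputable def LAu (q : ℤ) (n : ℕ) (ℓ : ℤ) : ℕ :=
  sSup {k : ℕ | ∃ C : Finset (Fin n → ℤ), IsVT q C ∧
    (∀ x ∈ C, ∀ y ∈ C, x ≠ y → 2 * ℓ + 1 ≤ du x y) ∧ C.card = k}

/-- `γ_n(r) = |C_n(r)|` where
`C_n(r) = {x ∈ Q^n : Σ (ℓ+1)^i x_i = α·S_n + r}`, `α = ⌊(q-1)/2⌋`,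
`S_n = Σ_{i<n} (ℓ+1)^i`. -/
noncomputable def gam (q ℓ : ℤ) (n : ℕ) (r : ℤ) : ℕ :=
  Set.ncard {x : Fin n → ℤ | inQ q x ∧
    ∑ i : Fin n, (ℓ + 1) ^ (i : ℕ) * x i
      = ((q - 1) / 2) * (∑ i ∈ Finset.range n, (ℓ + 1) ^ i) + r}

/-- `d(x,y)` is at most `ℓ` exactly when all coordinate differences are. -/
theorem dmax_le_iff {n : ℕ} {x y : Fin n → ℤ} {ℓ : ℤ} (hℓ : 0 ≤ ℓ) :
    dmax x y ≤ ℓ ↔ ∀ i, |x i - y i| ≤ ℓ := by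
  lift ℓ to ℕ using hℓ
  simp only [dmax, Nat.cast_le, Finset.sup_le_iff, Finset.mem_univ, true_imp_iff]
  exact forall_congr' fun i => by rw [Int.abs_eq_natAbs, Nat.cast_le]

/-- Two words of `Q^n` can be confused by asymmetric errors of level `ℓ` iff `d(x,y) ≤ ℓ`. -/
theorem exists_common_output_iff {q : ℤ} {n : ℕ} {ℓ : ℤ} (hℓ : 0 ≤ ℓ) {x y : Fin n → ℤ}
    (hx : inQ q x) (hy : inQ q y) :
    (∃ e f : Fin n → ℤ, (∀ i, 0 ≤ e i ∧ e i ≤ ℓ) ∧ (∀ i, 0 ≤ f i ∧ f i ≤ ℓ) ∧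
        x + e = y + f ∧ inQ q (x + e)) ↔ dmax x y ≤ ℓ := by
  rw [dmax_le_iff hℓ]
  constructor
  · rintro ⟨e, f, he, hf, hef, -⟩ i
    have h : x i + e i = y i + f i := congrFun hef i
    have := he i
    have := hf i
    rw [abs_le]
    omega
  · intro h
    refine ⟨x ⊔ y - x, x ⊔ y - y, fun i => ?_, fun i => ?_, by simp, fun i => ?_⟩
    all_goals
      have := abs_le.1 (h i)
      have := hx i
      have := hy i
      simp only [Pi.add_apply, Pi.sub_apply, Pi.sup_apply]
      omega

/-- `C ⊆ Q^n` is an `ℓ`-AEC code (no two distinct codewords admit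
error vectors `e, f ∈ {0,…,ℓ}^n` with `x + e = y + f ∈ Q^n`) iff
`d(x,y) ≥ ℓ+1` for all distinct `x, y ∈ C`. -/
theorem stmt1 (q : ℤ) (hq : 2 ≤ q) (n : ℕ) (hn : 1 ≤ n) (ℓ : ℤ) (hℓ : 0 ≤ ℓ)
    (C : Set (Fin n → ℤ)) (hC : ∀ x ∈ C, inQ q x) :
    (∀ x ∈ C, ∀ y ∈ C, x ≠ y →
        ¬ ∃ e f : Fin n → ℤ, (∀ i, 0 ≤ e i ∧ e i ≤ ℓ) ∧ (∀ i, 0 ≤ f i ∧ f i ≤ ℓ) ∧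
            x + e = y + f ∧ inQ q (x + e)) ↔
      (∀ x ∈ C, ∀ y ∈ C, x ≠ y → ℓ + 1 ≤ dmax x y) := by
  refine forall₂_congr fun x hx => forall₂_congr fun y hy => imp_congr_right fun _ => ?_
  rw [exists_common_output_iff hℓ (hC x hx) (hC y hy), not_le, Int.add_one_le_iff]
end

section
/- Let q ≥ 2 and n ≥ 1 be integers and let ℓ ∈ {0,1,…,q−1}. Then the maximum cardinality of an ℓ-AEC code C ⊆ Q^n equals ⌈q/(ℓ+1)⌉^n; that is, A_a(n,ℓ)_q = ⌈q/(ℓ+1)⌉^n. -/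
open Finset Filter

theorem dmax_lt_iff {n : ℕ} (x y : Fin n → ℤ) {p : ℤ} (hp : 0 < p) :
    dmax x y < p ↔ ∀ i, |x i - y i| < p := by
  obtain ⟨k, rfl⟩ := Int.eq_ofNat_of_zero_le hp.le
  have hk : (⊥ : ℕ) < k := by simpa using hp
  simp only [dmax, Nat.cast_lt, Finset.sup_lt_iff hk, Finset.mem_univ, true_imp_iff]
  refine forall_congr' fun i => ?_
  rw [← Int.natCast_natAbs, Nat.cast_lt]

theorem card_piFinset_Ico (n : ℕ) (m : ℤ) :
    (Fintype.piFinset fun _ : Fin n => Finset.Ico (0 : ℤ) m).card = m.toNat ^ n := by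
  simp [Fintype.card_piFinset]

/-- Reducing coordinates to blocks of length `p` is injective on a code of distance `p`. -/
theorem card_code_le {q p m : ℤ} {n : ℕ} (hp : 0 < p) (hqm : q ≤ m * p)
    {C : Finset (Fin n → ℤ)} (hC : ∀ x ∈ C, inQ q x)
    (hd : ∀ x ∈ C, ∀ y ∈ C, x ≠ y → p ≤ dmax x y) : C.card ≤ m.toNat ^ n := by
  rw [← card_piFinset_Ico n m]
  refine Finset.card_le_card_of_injOn (fun x i => x i / p) ?_ ?_
  · intro x hx
    simp only [Finset.mem_coe, Fintype.mem_piFinset, Finset.mem_Ico]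
    intro i
    obtain ⟨h0, h1⟩ := hC x hx i
    exact ⟨Int.ediv_nonneg h0 hp.le, Int.ediv_lt_of_lt_mul hp (by linarith)⟩
  · intro x hx y hy hxy
    by_contra hne
    refine absurd ((dmax_lt_iff x y hp).2 fun i => ?_) (not_lt.2 (hd x hx y hy hne))
    have hi : x i / p = y i / p := congrFun hxy i
    have hx' := Int.mul_ediv_add_emod (x i) p
    have hy' := Int.mul_ediv_add_emod (y i) p
    rw [hi] at hx'
    rw [abs_lt]
    constructor <;> linarith [Int.emod_nonneg (x i) hp.ne', Int.emod_lt_of_pos (x i) hp,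
      Int.emod_nonneg (y i) hp.ne', Int.emod_lt_of_pos (y i) hp]

/-- The words with all coordinates divisible by `p` form a code of distance `p`. -/
theorem exists_code_card_eq {q p m : ℤ} (n : ℕ) (hp : 0 < p) (hmq : (m - 1) * p < q) :
    ∃ C : Finset (Fin n → ℤ), (∀ x ∈ C, inQ q x) ∧
      (∀ x ∈ C, ∀ y ∈ C, x ≠ y → p ≤ dmax x y) ∧ C.card = m.toNat ^ n := by
  have hinj : Function.Injective fun (x : Fin n → ℤ) i => p * x i := fun x y h =>
    funext fun i => mul_left_cancel₀ hp.ne' (congrFun h i)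
  refine ⟨(Fintype.piFinset fun _ : Fin n => Finset.Ico (0 : ℤ) m).image
    fun x i => p * x i, ?_, ?_, ?_⟩
  · simp only [Finset.forall_mem_image, Fintype.mem_piFinset, Finset.mem_Ico]
    intro x hx i
    obtain ⟨h0, h1⟩ := hx i
    exact ⟨by positivity, by nlinarith⟩
  · simp only [Finset.forall_mem_image]
    intro x _ y _ hne
    by_contra! hlt
    refine hne (funext fun i => ?_)
    have hi := (dmax_lt_iff _ _ hp).1 hlt i
    have h0 := Int.eq_zero_of_abs_lt_dvd (Dvd.intro _ (mul_sub p (x i) (y i))) hi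
    linarith
  · rw [Finset.card_image_of_injective _ hinj, card_piFinset_Ico]

/-- `A_a(n,ℓ)_q = ⌈q/(ℓ+1)⌉^n`. -/
theorem stmt4 (q : ℤ) (hq : 2 ≤ q) (n : ℕ) (hn : 1 ≤ n) (ℓ : ℤ)
    (hℓ0 : 0 ≤ ℓ) (hℓq : ℓ ≤ q - 1) :
    (Aa q n ℓ : ℤ) = ⌈(q : ℚ) / ((ℓ : ℚ) + 1)⌉ ^ n := by
  set m := ⌈(q : ℚ) / ((ℓ : ℚ) + 1)⌉ with hm
  have hp : 0 < ℓ + 1 := by linarith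
  have hpQ : (0 : ℚ) < (ℓ : ℚ) + 1 := by exact_mod_cast hp
  have hqm : q ≤ m * (ℓ + 1) := by
    have h := Int.le_ceil ((q : ℚ) / ((ℓ : ℚ) + 1))
    rw [← hm, div_le_iff₀ hpQ] at h
    exact_mod_cast h
  have hmq : (m - 1) * (ℓ + 1) < q := by
    have h := sub_lt_iff_lt_add.2 (Int.ceil_lt_add_one ((q : ℚ) / ((ℓ : ℚ) + 1)))
    rw [← hm, lt_div_iff₀ hpQ] at h
    exact_mod_cast h
  have hm0 : 0 ≤ m := by
    by_contra! h
    nlinarith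
  have hA : Aa q n ℓ = m.toNat ^ n := by
    refine IsGreatest.csSup_eq ⟨exists_code_card_eq n hp hmq, ?_⟩
    rintro _ ⟨C, hC, hd, rfl⟩
    exact card_code_le hp hqm hC hd
  rw [hA, Nat.cast_pow, Int.toNat_of_nonneg hm0]
end

section
/- Let n ≥ 1 and ℓ ≥ 0 be integers and set q = 2ℓ + 2. Then the maximum cardinality of an ℓ-UEC code C ⊆ Q^n equals 2^n; that is, A_u(n,ℓ)_{2ℓ+2} = 2^n. -/
open Finset Filter

theorem natAbs_sub_le_dmax {n : ℕ} (x y : Fin n → ℤ) (i : Fin n) :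
    ((x i - y i).natAbs : ℤ) ≤ dmax x y := by
  unfold dmax
  exact_mod_cast Finset.le_sup (f := fun i => (x i - y i).natAbs) (Finset.mem_univ i)

theorem dmax_le_of_forall {n : ℕ} {x y : Fin n → ℤ} {m : ℤ} (hm : 0 ≤ m)
    (h : ∀ i, |x i - y i| ≤ m) : dmax x y ≤ m := by
  lift m to ℕ using hm
  unfold dmax
  have : (Finset.univ.sup fun i => (x i - y i).natAbs) ≤ m :=
    Finset.sup_le fun i _ => by have := abs_le.1 (h i); omega
  exact_mod_cast this

theorem dmax_le_du {n : ℕ} (x y : Fin n → ℤ) : dmax x y ≤ du x y := by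
  have : 0 ≤ dmax x y := Int.natCast_nonneg _
  unfold du
  split_ifs <;> omega

theorem du_le_two_mul_dmax {n : ℕ} (x y : Fin n → ℤ) : du x y ≤ 2 * dmax x y := by
  have : 0 ≤ dmax x y := Int.natCast_nonneg _
  unfold du
  split_ifs <;> omega

/-- Splitting the alphabet into two halves of size `ℓ + 1` separates the codewords. -/
theorem card_le_two_pow_of_du {n : ℕ} {ℓ : ℤ} (hℓ : 0 ≤ ℓ) {C : Finset (Fin n → ℤ)}
    (hQ : ∀ x ∈ C, inQ (2 * ℓ + 2) x)
    (hC : ∀ x ∈ C, ∀ y ∈ C, x ≠ y → 2 * ℓ + 1 ≤ du x y) : C.card ≤ 2 ^ n := by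
  have hinj : Set.InjOn (fun (x : Fin n → ℤ) i => decide (x i ≤ ℓ)) C := by
    intro x hx y hy hxy
    by_contra hne
    have hd := hC x hx y hy hne
    have hle : dmax x y ≤ ℓ := dmax_le_of_forall hℓ fun i => by
      have hi : x i ≤ ℓ ↔ y i ≤ ℓ := by simpa using congrFun hxy i
      have hxi := hQ x hx i
      have hyi := hQ y hy i
      rw [abs_le]
      omega
    have := du_le_two_mul_dmax x y
    omega
  calc C.card ≤ (Finset.univ : Finset (Fin n → Bool)).card :=
        Finset.card_le_card_of_injOn _ (fun _ _ => Finset.mem_coe.2 (Finset.mem_univ _)) hinj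
    _ = 2 ^ n := by simp

/-- `A_u(n,ℓ)_{2ℓ+2} = 2^n`. -/
theorem stmt5 (n : ℕ) (hn : 1 ≤ n) (ℓ : ℤ) (hℓ : 0 ≤ ℓ) :
    Au (2 * ℓ + 2) n ℓ = 2 ^ n := by
  refine IsGreatest.csSup_eq ⟨?_, ?_⟩
  · refine ⟨Fintype.piFinset fun _ => {0, 2 * ℓ + 1}, ?_, ?_, ?_⟩
    · intro x hx i
      have := Fintype.mem_piFinset.1 hx i
      simp only [Finset.mem_insert, Finset.mem_singleton] at this
      omega
    · intro x hx y hy hne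
      obtain ⟨i, hi⟩ := Function.ne_iff.1 hne
      have hxi := Fintype.mem_piFinset.1 hx i
      have hyi := Fintype.mem_piFinset.1 hy i
      simp only [Finset.mem_insert, Finset.mem_singleton] at hxi hyi
      have h₁ := natAbs_sub_le_dmax x y i
      have h₂ := dmax_le_du x y
      omega
    · rw [Fintype.card_piFinset_const, Finset.card_pair (by omega)]
  · rintro k ⟨C, hQ, hC, rfl⟩
    exact card_le_two_pow_of_du hℓ hQ hC
end

section
/- Let q ≥ 2, n ≥ 1, m ≥ 1 and ℓ ≥ 0 be integers, and let X ⊆ Q^n be an ℓ-AEC code. For x ∈ X let S(x) denote the sum of its entries, and let integers s₁ ≤ s₂ be such that s₁ ≤ S(x) ≤ s₂ for every x ∈ X. Let φ : {s₁, s₁+1, …, s₂} → Q^m be a map such that for all a, b ∈ {s₁,…,s₂} with a > b there is an index i ∈ {1,…,m} with (φ(a))_i < (φ(b))_i. Then the code C = {(x, φ(S(x))) : x ∈ X} ⊆ Q^{n+m} (concatenation of x with φ(S(x))) is an ℓ-UEC code. -/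
open Finset Filter

theorem dmax_le_dmax_append {n m : ℕ} (x y : Fin n → ℤ) (a b : Fin m → ℤ) :
    dmax x y ≤ dmax (Fin.append x a) (Fin.append y b) := by
  unfold dmax
  refine Nat.cast_le.mpr (Finset.sup_le fun i _ => ?_)
  simpa using Finset.le_sup (f := fun j => (Fin.append x a j - Fin.append y b j).natAbs)
    (Finset.mem_univ (Fin.castAdd m i))

theorem inQ_append {q : ℤ} {n m : ℕ} {x : Fin n → ℤ} {a : Fin m → ℤ}
    (hx : inQ q x) (ha : inQ q a) : inQ q (Fin.append x a) := by
  intro i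
  refine Fin.addCases (fun j => ?_) (fun j => ?_) i
  · simpa using hx j
  · simpa using ha j

/-- A word with a strictly larger sum whose tail drops somewhere cannot dominate. -/
theorem not_append_le_append {n m : ℕ} {φ : ℤ → Fin m → ℤ} {x y : Fin n → ℤ} (hxy : x ≠ y)
    (hφ : ∑ i, y i < ∑ i, x i → ∃ i, φ (∑ i, x i) i < φ (∑ i, y i) i) :
    ¬ ∀ i, Fin.append y (φ (∑ i, y i)) i ≤ Fin.append x (φ (∑ i, x i)) i := by
  intro h
  have hle : y ≤ x := fun i => by simpa using h (Fin.castAdd m i)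
  obtain ⟨i, hi⟩ := hφ (Fintype.sum_strictMono (lt_of_le_of_ne hle hxy.symm))
  have := h (Fin.natAdd n i)
  simp only [Fin.append_right] at this
  omega

/-- adding tails to an `ℓ`-AEC code yields an `ℓ`-UEC code.
`C = {(x, φ(S(x))) : x ∈ X} ⊆ Q^{n+m}` is an `ℓ`-UEC code. -/
theorem stmt8 (q : ℤ) (hq : 2 ≤ q) (n m : ℕ) (hn : 1 ≤ n) (hm : 1 ≤ m)
    (ℓ : ℤ) (hℓ : 0 ≤ ℓ)
    (X : Set (Fin n → ℤ)) (hXQ : ∀ x ∈ X, inQ q x)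
    (hXaec : ∀ x ∈ X, ∀ y ∈ X, x ≠ y → ℓ + 1 ≤ dmax x y)
    (s₁ s₂ : ℤ) (hs₁s₂ : s₁ ≤ s₂)
    (hS : ∀ x ∈ X, s₁ ≤ ∑ i, x i ∧ ∑ i, x i ≤ s₂)
    (φ : ℤ → Fin m → ℤ) (hφQ : ∀ s, s₁ ≤ s → s ≤ s₂ → inQ q (φ s))
    (hφ : ∀ a b : ℤ, s₁ ≤ a → a ≤ s₂ → s₁ ≤ b → b ≤ s₂ → b < a →
      ∃ i, φ a i < φ b i) :
    (∀ z ∈ {z : Fin (n + m) → ℤ | ∃ x ∈ X, z = Fin.append x (φ (∑ i, x i))},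
        inQ q z) ∧
    (∀ u ∈ {z : Fin (n + m) → ℤ | ∃ x ∈ X, z = Fin.append x (φ (∑ i, x i))},
      ∀ v ∈ {z : Fin (n + m) → ℤ | ∃ x ∈ X, z = Fin.append x (φ (∑ i, x i))},
        u ≠ v → 2 * ℓ + 1 ≤ du u v) := by
  refine ⟨?_, ?_⟩
  · rintro _ ⟨x, hx, rfl⟩
    exact inQ_append (hXQ x hx) (hφQ _ (hS x hx).1 (hS x hx).2)
  · rintro _ ⟨x, hx, rfl⟩ _ ⟨y, hy, rfl⟩ huv
    have hxy : x ≠ y := fun h => huv (by rw [h])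
    obtain ⟨hx₁, hx₂⟩ := hS x hx
    obtain ⟨hy₁, hy₂⟩ := hS y hy
    have h₁ := not_append_le_append hxy (hφ _ _ hx₁ hx₂ hy₁ hy₂)
    have h₂ := not_append_le_append hxy.symm (hφ _ _ hy₁ hy₂ hx₁ hx₂)
    rw [du, if_neg (not_or.mpr ⟨h₁, h₂⟩)]
    have hd := hXaec x hx y hy hxy
    have hle := dmax_le_dmax_append x y (φ (∑ i, x i)) (φ (∑ i, y i))
    omega
end

section
/- Let q ≥ 2, n ≥ 1 and ℓ ≥ 0 be integers. Then LA_a(n,ℓ)_q = LA_u(n,ℓ)_q, i.e., the maximum cardinality of a VT-type ℓ-AEC code of length n over Q equals the maximum cardinality of a VT-type ℓ-UEC code of length n over Q. -/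
open Finset Filter

theorem one_le_dmax {n : ℕ} {x y : Fin n → ℤ} (h : x ≠ y) : 1 ≤ dmax x y := by
  obtain ⟨i, hi⟩ := Function.ne_iff.mp h
  have h1 : (x i - y i).natAbs ≤ Finset.univ.sup fun i => (x i - y i).natAbs :=
    Finset.le_sup (f := fun i => (x i - y i).natAbs) (Finset.mem_univ i)
  unfold dmax
  omega

/-- Every `ℓ`-UEC pair is an `ℓ`-AEC pair. -/
theorem le_dmax_of_le_du {n : ℕ} {ℓ : ℤ} (hℓ : 0 ≤ ℓ) {x y : Fin n → ℤ}
    (h : 2 * ℓ + 1 ≤ du x y) : ℓ + 1 ≤ dmax x y := by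
  unfold du at h
  split_ifs at h <;> omega

/-- Complement, within `{0,…,q-1}`, the coordinates at which `coef` is negative. -/
def flipNeg (q : ℤ) {n : ℕ} (coef x : Fin n → ℤ) : Fin n → ℤ :=
  fun i => if coef i < 0 then q - 1 - x i else x i

theorem flipNeg_flipNeg (q : ℤ) {n : ℕ} (coef x : Fin n → ℤ) :
    flipNeg q coef (flipNeg q coef x) = x := by
  funext i
  unfold flipNeg
  split_ifs <;> ring

theorem flipNeg_injective (q : ℤ) {n : ℕ} (coef : Fin n → ℤ) :
    Function.Injective (flipNeg q coef) :=
  Function.LeftInverse.injective (flipNeg_flipNeg q coef)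

theorem inQ_flipNeg {q : ℤ} {n : ℕ} {coef x : Fin n → ℤ} :
    inQ q (flipNeg q coef x) ↔ inQ q x := by
  refine forall_congr' fun i => ?_
  unfold flipNeg
  split_ifs <;> omega

theorem dmax_flipNeg (q : ℤ) {n : ℕ} (coef x y : Fin n → ℤ) :
    dmax (flipNeg q coef x) (flipNeg q coef y) = dmax x y := by
  unfold dmax
  congr 2
  funext i
  unfold flipNeg
  split_ifs <;> omega

theorem sum_mul_flipNeg (q : ℤ) {n : ℕ} (coef x : Fin n → ℤ) :
    ∑ i, coef i * flipNeg q coef x i =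
      ∑ i, |coef i| * x i + ∑ i, if coef i < 0 then coef i * (q - 1) else 0 := by
  rw [← Finset.sum_add_distrib]
  refine Finset.sum_congr rfl fun i _ => ?_
  unfold flipNeg
  split_ifs with h
  · rw [abs_of_neg h]; ring
  · rw [abs_of_nonneg (not_lt.mp h)]; ring

/-- Two comparable words on which a linear form with positive coefficients agrees are equal. -/
theorem eq_of_le_of_sum_mul_eq {n : ℕ} {coef x y : Fin n → ℤ} (hc : ∀ i, 0 < coef i)
    (hxy : ∀ i, x i ≤ y i) (h : ∑ i, coef i * x i = ∑ i, coef i * y i) : x = y := by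
  have key := (Finset.sum_eq_sum_iff_of_le
    (fun i _ => mul_le_mul_of_nonneg_left (hxy i) (hc i).le)).mp h
  funext i
  exact mul_left_cancel₀ (hc i).ne' (key i (Finset.mem_univ i))

/-- A nonempty VT-type code with minimum distance at least `2` has no zero coefficient. -/
theorem coef_ne_zero {q : ℤ} (hq : 2 ≤ q) {n : ℕ} {ℓ : ℤ} (hℓ : 1 ≤ ℓ)
    {C : Finset (Fin n → ℤ)} {coef : Fin n → ℤ} {a : ℤ}
    (hC : ∀ x, x ∈ C ↔ (inQ q x ∧ ∑ i, coef i * x i = a))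
    (hd : ∀ x ∈ C, ∀ y ∈ C, x ≠ y → ℓ + 1 ≤ dmax x y)
    {x : Fin n → ℤ} (hx : x ∈ C) (i : Fin n) : coef i ≠ 0 := by
  intro hi
  obtain ⟨hxQ, hxa⟩ := (hC x).mp hx
  obtain ⟨t, ht0, htq, htne, hdist⟩ :
      ∃ t : ℤ, 0 ≤ t ∧ t ≤ q - 1 ∧ t ≠ x i ∧ (x i - t).natAbs ≤ 1 := by
    have := hxQ i
    by_cases h : x i = 0
    · exact ⟨1, by omega, by omega, by omega, by omega⟩
    · exact ⟨x i - 1, by omega, by omega, by omega, by omega⟩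
  have hy : Function.update x i t ∈ C := by
    refine (hC _).mpr ⟨fun j => ?_, ?_⟩
    · by_cases hj : j = i
      · subst hj; simp [ht0, htq]
      · simpa [hj] using hxQ j
    · rw [← hxa]
      refine Finset.sum_congr rfl fun j _ => ?_
      by_cases hj : j = i
      · subst hj; simp [hi]
      · simp [hj]
  have hne : x ≠ Function.update x i t := by
    intro h
    have := congrFun h i
    simp only [Function.update_self] at this
    exact htne this.symm
  have hle : (Finset.univ.sup fun j => (x j - Function.update x i t j).natAbs) ≤ 1 := by
    refine Finset.sup_le fun j _ => ?_
    by_cases hj : j = i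
    · subst hj; simpa using hdist
    · simp [hj]
  have := hd x hx _ hy hne
  unfold dmax at this
  omega

/-- Every VT-type `ℓ`-AEC code can be turned into a VT-type `ℓ`-UEC code of the same size. -/
theorem exists_uec_of_aec {q : ℤ} (hq : 2 ≤ q) {n : ℕ} {ℓ : ℤ} (hℓ : 0 ≤ ℓ)
    {C : Finset (Fin n → ℤ)} (hVT : IsVT q C)
    (hd : ∀ x ∈ C, ∀ y ∈ C, x ≠ y → ℓ + 1 ≤ dmax x y) :
    ∃ D : Finset (Fin n → ℤ), IsVT q D ∧
      (∀ x ∈ D, ∀ y ∈ D, x ≠ y → 2 * ℓ + 1 ≤ du x y) ∧ D.card = C.card := by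
  obtain rfl | hℓ := hℓ.eq_or_lt
  · exact ⟨C, hVT, fun x _ y _ hxy => by
      linarith [one_le_dmax hxy, dmax_le_du x y], rfl⟩
  obtain ⟨coef, a, hC⟩ := hVT
  have hmem : ∀ x, x ∈ C.image (flipNeg q coef) ↔ flipNeg q coef x ∈ C := fun x =>
    ⟨fun h => by
      obtain ⟨y, hy, rfl⟩ := Finset.mem_image.mp h
      rwa [flipNeg_flipNeg],
    fun h => Finset.mem_image.mpr ⟨_, h, flipNeg_flipNeg q coef x⟩⟩
  have hD : ∀ x, x ∈ C.image (flipNeg q coef) ↔ (inQ q x ∧ ∑ i, |coef i| * x i =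
      a - ∑ i, if coef i < 0 then coef i * (q - 1) else 0) := fun x => by
    rw [hmem, hC, inQ_flipNeg, sum_mul_flipNeg, eq_sub_iff_add_eq]
  refine ⟨C.image (flipNeg q coef), ⟨_, _, hD⟩, fun x hx y hy hxy => ?_,
    Finset.card_image_of_injective _ (flipNeg_injective q coef)⟩
  have hpos : ∀ i, 0 < |coef i| := fun i =>
    abs_pos.mpr (coef_ne_zero hq hℓ hC hd ((hmem x).mp hx) i)
  have hsum : ∑ i, |coef i| * x i = ∑ i, |coef i| * y i :=
    ((hD x).mp hx).2.trans ((hD y).mp hy).2.symm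
  have hdist := hd _ ((hmem x).mp hx) _ ((hmem y).mp hy) ((flipNeg_injective q coef).ne hxy)
  rw [dmax_flipNeg] at hdist
  unfold du
  rw [if_neg]
  · linarith
  · rintro (h | h)
    · exact hxy (eq_of_le_of_sum_mul_eq hpos h hsum.symm).symm
    · exact hxy (eq_of_le_of_sum_mul_eq hpos h hsum)

/-- `LA_a(n,ℓ)_q = LA_u(n,ℓ)_q`. -/
theorem stmt10 (q : ℤ) (hq : 2 ≤ q) (n : ℕ) (hn : 1 ≤ n) (ℓ : ℤ) (hℓ : 0 ≤ ℓ) :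
    LAa q n ℓ = LAu q n ℓ := by
  unfold LAa LAu
  congr 1
  ext k
  constructor
  · rintro ⟨C, hVT, hd, rfl⟩
    exact exists_uec_of_aec hq hℓ hVT hd
  · rintro ⟨C, hVT, hd, rfl⟩
    exact ⟨C, hVT, fun x hx y hy hxy => le_dmax_of_le_du hℓ (hd x hx y hy hxy), rfl⟩
end

section
/- Let q ≥ 2, n ≥ 1 and ℓ ≥ 1 be integers and let Q = {0,1,…,q−1}. Let a_0,…,a_{n−1} be positive integers such that the only vector e ∈ {−ℓ,…,ℓ}^n of integers with Σ_{i=0}^{n−1} a_i e_i = 0 is the zero vector, and set S = a_0 + ⋯ + a_{n−1}. Then for every integer a, the code C* = {(z_0,…,z_{n−1}) ∈ Q^n : Σ_{i=0}^{n−1} a_i z_i ≡ a (mod 2ℓS+1)} is an ℓ-UEC code. -/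
open Finset Filter

theorem abs_sub_le_dmax {n : ℕ} (x y : Fin n → ℤ) (i : Fin n) : |x i - y i| ≤ dmax x y := by
  rw [Int.abs_eq_natAbs, dmax]
  exact_mod_cast Finset.le_sup (f := fun i => (x i - y i).natAbs) (Finset.mem_univ i)

theorem abs_sum_mul_le {n : ℕ} {a e : Fin n → ℤ} {k : ℤ} (ha : ∀ i, 0 < a i)
    (he : ∀ i, |e i| ≤ k) : |∑ i, a i * e i| ≤ k * ∑ i, a i := by
  rw [Finset.mul_sum]
  refine (Finset.abs_sum_le_sum_abs _ _).trans (Finset.sum_le_sum fun i _ => ?_)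
  rw [abs_mul, abs_of_pos (ha i), mul_comm]
  exact mul_le_mul_of_nonneg_right (he i) (ha i).le

theorem eq_of_le_of_sum_mul_sub_eq_zero {n : ℕ} {a x y : Fin n → ℤ} (ha : ∀ i, 0 < a i)
    (hxy : ∀ i, y i ≤ x i) (h : ∑ i, a i * (x i - y i) = 0) : x = y := by
  rw [Finset.sum_eq_zero_iff_of_nonneg
    fun i _ => mul_nonneg (ha i).le (sub_nonneg.2 (hxy i))] at h
  funext i
  exact sub_eq_zero.1 ((mul_eq_zero.1 (h i (Finset.mem_univ i))).resolve_left (ha i).ne')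

/-- if `a_0,…,a_{n-1} > 0` and the only `e ∈ [-ℓ,ℓ]^n` with
`Σ aᵢ eᵢ = 0` is `e = 0`, then for `S = Σ aᵢ` and any integer `a`, the code
`C* = {z ∈ Q^n : Σ aᵢ zᵢ ≡ a (mod 2ℓS+1)}` is an `ℓ`-UEC code. -/
theorem stmt11 (q : ℤ) (hq : 2 ≤ q) (n : ℕ) (hn : 1 ≤ n) (ℓ : ℤ) (hℓ : 1 ≤ ℓ)
    (a : Fin n → ℤ) (hpos : ∀ i, 0 < a i)
    (hker : ∀ e : Fin n → ℤ, (∀ i, -ℓ ≤ e i ∧ e i ≤ ℓ) →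
      ∑ i, a i * e i = 0 → e = 0)
    (A : ℤ) :
    ∀ z ∈ {z : Fin n → ℤ | inQ q z ∧
        ∑ i, a i * z i ≡ A [ZMOD 2 * ℓ * (∑ i, a i) + 1]},
      ∀ z' ∈ {z : Fin n → ℤ | inQ q z ∧
          ∑ i, a i * z i ≡ A [ZMOD 2 * ℓ * (∑ i, a i) + 1]},
        z ≠ z' → 2 * ℓ + 1 ≤ du z z' := by
  rintro z ⟨-, hz⟩ z' ⟨-, hz'⟩ hne
  have hsub : ∑ i, a i * (z i - z' i) = ∑ i, a i * z i - ∑ i, a i * z' i := by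
    simp only [mul_sub, Finset.sum_sub_distrib]
  have hdvd : 2 * ℓ * (∑ i, a i) + 1 ∣ ∑ i, a i * (z i - z' i) := by
    rw [hsub]
    exact (hz'.trans hz.symm).dvd
  have hzero (hd : dmax z z' ≤ 2 * ℓ) : ∑ i, a i * (z i - z' i) = 0 := by
    refine Int.eq_zero_of_abs_lt_dvd hdvd ?_
    have := abs_sum_mul_le hpos fun i => (abs_sub_le_dmax z z' i).trans hd
    omega
  by_contra! hlt
  unfold du at hlt
  split_ifs at hlt with hcomp
  · have h0 := hzero (by omega)
    rcases hcomp with h | h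
    · exact hne (eq_of_le_of_sum_mul_sub_eq_zero hpos h h0)
    · refine hne (eq_of_le_of_sum_mul_sub_eq_zero hpos h ?_).symm
      simp only [mul_sub, Finset.sum_sub_distrib] at h0 ⊢
      linarith
  · have he := hker (fun i => z i - z' i)
      (fun i => abs_le.1 ((abs_sub_le_dmax z z' i).trans (by omega))) (hzero (by omega))
    exact hne (funext fun i => sub_eq_zero.1 (congrFun he i))
end

section
/- Let q ≥ 2 and ℓ ≥ 1 be integers, α = ⌊(q−1)/2⌋. Let u_1, u_2, … and v_1, v_2, … be sequences of integers such that: (1) 0 ≤ u_1 + α ≤ v_1 + α ≤ q − 1; and for each n ≥ 2: (2) ⌈(u_n + α − (q−1))/(ℓ+1)⌉ ≥ u_{n−1}; (3) ⌊(v_n + α)/(ℓ+1)⌋ ≤ v_{n−1}; (4) either ℓ+1 divides q, or for each integer r with u_n ≤ r ≤ v_n, the residue of α + r modulo ℓ+1 is strictly less than the residue of q modulo ℓ+1. Then for every n ≥ 1 and every integer r with u_n ≤ r ≤ v_n, γ_n(r) = ⌈q/(ℓ+1)⌉^{n−1}. -/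
open Finset Filter

/-- The words `x ∈ Q^n` with `∑ mⁱ xᵢ = s`. -/
def wordsOfWeight (q m : ℤ) (n : ℕ) (s : ℤ) : Set (Fin n → ℤ) :=
  {x | inQ q x ∧ ∑ i : Fin n, m ^ (i : ℕ) * x i = s}

lemma wordsOfWeight_finite (q m : ℤ) (n : ℕ) (s : ℤ) : (wordsOfWeight q m n s).Finite := by
  refine (Set.Finite.pi' fun _ : Fin n => Set.finite_Icc (0 : ℤ) (q - 1)).subset ?_
  exact fun x hx i => hx.1 i

lemma cons_mem_wordsOfWeight (q m : ℤ) (n : ℕ) (s a : ℤ) (y : Fin n → ℤ) :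
    (Fin.cons a y : Fin (n + 1) → ℤ) ∈ wordsOfWeight q m (n + 1) s ↔
      (0 ≤ a ∧ a ≤ q - 1) ∧ inQ q y ∧ a + m * ∑ i : Fin n, m ^ (i : ℕ) * y i = s := by
  simp only [wordsOfWeight, inQ, Set.mem_ofPred_eq, Fin.forall_fin_succ, Fin.sum_univ_succ,
    Fin.cons_zero, Fin.cons_succ, Fin.val_zero, Fin.val_succ, pow_zero, one_mul, pow_succ',
    mul_assoc, Finset.mul_sum, and_assoc]

/-- If all the weights reachable after removing the first letter have `c` words, then the number
of words is `c` times the number of admissible first letters. -/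
lemma ncard_wordsOfWeight_succ {q m : ℤ} (hm : 0 < m) {n : ℕ} {s : ℤ} {c : ℕ}
    (h : ∀ a t : ℤ, 0 ≤ a → a ≤ q - 1 → a + m * t = s → (wordsOfWeight q m n t).ncard = c) :
    (wordsOfWeight q m (n + 1) s).ncard = #{a ∈ Icc 0 (q - 1) | m ∣ s - a} * c := by
  classical
  have hfin := wordsOfWeight_finite q m (n + 1) s
  rw [Set.ncard_eq_toFinset_card _ hfin, Finset.card_eq_sum_card_fiberwise (f := fun x => x 0)
    (t := {a ∈ Icc 0 (q - 1) | m ∣ s - a}), Finset.sum_const_nat]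
  · intro a ha
    obtain ⟨⟨ha0, ha1⟩, t, ht⟩ : (0 ≤ a ∧ a ≤ q - 1) ∧ m ∣ s - a := by simpa using ha
    rw [← h a t ha0 ha1 (by linarith), ← Set.ncard_coe_finset,
      ← Set.ncard_image_of_injective (wordsOfWeight q m n t)
        (Fin.cons_right_injective (α := fun _ => ℤ) a)]
    refine congrArg Set.ncard (Set.ext fun x => ?_)
    refine Fin.consCases (fun b y => ?_) x
    simp only [Finset.coe_filter, Set.Finite.mem_toFinset, cons_mem_wordsOfWeight,
      Set.mem_ofPred_eq, Set.mem_image, Fin.cons_inj, Fin.cons_zero]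
    constructor
    · rintro ⟨⟨_, hy, hs⟩, rfl⟩
      exact ⟨y, ⟨hy, mul_left_cancel₀ hm.ne' (by linarith)⟩, rfl, rfl⟩
    · rintro ⟨z, ⟨hz, hs⟩, rfl, rfl⟩
      exact ⟨⟨⟨ha0, ha1⟩, hz, by rw [hs]; linarith⟩, rfl⟩
  · intro x
    refine Fin.consCases (fun b y => ?_) x
    simp only [Finset.mem_coe, Set.Finite.mem_toFinset, cons_mem_wordsOfWeight,
      Finset.mem_filter, Finset.mem_Icc, Fin.cons_zero]
    rintro ⟨hb, _, hs⟩
    exact ⟨hb, _, by rw [← hs, add_sub_cancel_left]⟩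

lemma ncard_wordsOfWeight_one {q m s : ℤ} (h0 : 0 ≤ s) (h1 : s ≤ q - 1) :
    (wordsOfWeight q m 1 s).ncard = 1 := by
  rw [Set.ncard_eq_one]
  refine ⟨fun _ => s, Set.ext fun x => ?_⟩
  simp only [wordsOfWeight, inQ, Set.mem_ofPred_eq, Set.mem_singleton_iff, funext_iff,
    Fin.forall_fin_one, Fin.sum_univ_one, Fin.val_zero, pow_zero, one_mul]
  constructor
  · exact fun h => h.2
  · rintro rfl
    exact ⟨⟨h0, h1⟩, rfl⟩

/-- The interval `[0, q - 1]` contains exactly `⌈q / m⌉` integers congruent to `s` modulo `m`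
if `m ∣ q` or the residue of `s` is less than that of `q`. -/
lemma card_filter_dvd_sub {q m s : ℤ} (hq : 0 ≤ q) (hm : 0 < m)
    (h : m ∣ q ∨ s % m < q % m) :
    (#{a ∈ Icc 0 (q - 1) | m ∣ s - a} : ℤ) = ⌈(q : ℚ) / (m : ℚ)⌉ := by
  obtain ⟨k, hk⟩ : ∃ k, k = ⌈(q : ℚ) / (m : ℚ)⌉ := ⟨_, rfl⟩
  have hmQ : (0 : ℚ) < m := by exact_mod_cast hm
  obtain ⟨hlt, hle⟩ := Int.ceil_eq_iff.1 hk.symm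
  rw [lt_div_iff₀ hmQ] at hlt
  rw [div_le_iff₀ hmQ] at hle
  have hlt : (k - 1) * m < q := by exact_mod_cast hlt
  have hle : q ≤ k * m := by exact_mod_cast hle
  have hk0 : 0 ≤ k := by
    by_contra! hneg
    nlinarith
  have hs0 := Int.emod_nonneg s hm.ne'
  have hs1 := Int.emod_lt_of_pos s hm
  have hlast : (k - 1) * m + s % m < q := by
    rcases h with ⟨t, rfl⟩ | h
    · have : k - 1 < t := by nlinarith
      have : k ≤ t := by omega
      nlinarith
    · have h1 := Int.mul_ediv_add_emod q m
      have : k - 1 < q / m + 1 := by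
        have := Int.emod_lt_of_pos q hm
        by_contra! hc
        nlinarith
      have : k - 1 ≤ q / m := by omega
      nlinarith
  have himg : ({a ∈ Icc 0 (q - 1) | m ∣ s - a} : Finset ℤ) =
      (Ico 0 k).image fun j => j * m + s % m := by
    have hs := Int.mul_ediv_add_emod s m
    ext a
    simp only [Finset.mem_filter, Finset.mem_Icc, Finset.mem_image, Finset.mem_Ico]
    constructor
    · rintro ⟨⟨ha0, ha1⟩, t, ht⟩
      refine ⟨s / m - t, ⟨?_, ?_⟩, by linarith⟩
      · by_contra! hc
        have : s / m - t ≤ -1 := by omega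
        nlinarith
      · by_contra! hc
        nlinarith
    · rintro ⟨j, ⟨hj0, hj1⟩, rfl⟩
      have hj : j ≤ k - 1 := by omega
      have : j * m ≤ (k - 1) * m := mul_le_mul_of_nonneg_right hj hm.le
      have : 0 ≤ j * m := mul_nonneg hj0 hm.le
      exact ⟨⟨by linarith, by omega⟩, s / m - j, by linarith⟩
  rw [himg, Finset.card_image_of_injective, Int.card_Ico, ← hk, sub_zero, Int.toNat_of_nonneg hk0]
  intro i j hij
  exact mul_right_cancel₀ hm.ne' (add_right_cancel hij)

/-- under conditions (1)–(4) on the sequences `u, v`,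
`γ_n(r) = ⌈q/(ℓ+1)⌉^{n-1}` for all `n ≥ 1` and `r ∈ [u_n, v_n]`.
Here `α = ⌊(q-1)/2⌋`. -/
theorem stmt14 (q ℓ : ℤ) (hq : 2 ≤ q) (hℓ : 1 ≤ ℓ) (u v : ℕ → ℤ)
    (h1a : 0 ≤ u 1 + (q - 1) / 2)
    (h1b : u 1 + (q - 1) / 2 ≤ v 1 + (q - 1) / 2)
    (h1c : v 1 + (q - 1) / 2 ≤ q - 1)
    (h2 : ∀ n : ℕ, 2 ≤ n →
      u (n - 1) ≤ ⌈((u n + (q - 1) / 2 - (q - 1) : ℤ) : ℚ) / ((ℓ : ℚ) + 1)⌉)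
    (h3 : ∀ n : ℕ, 2 ≤ n →
      ⌊((v n + (q - 1) / 2 : ℤ) : ℚ) / ((ℓ : ℚ) + 1)⌋ ≤ v (n - 1))
    (h4 : ∀ n : ℕ, 2 ≤ n → ((ℓ + 1) ∣ q ∨
      ∀ r : ℤ, u n ≤ r → r ≤ v n →
        ((q - 1) / 2 + r) % (ℓ + 1) < q % (ℓ + 1))) :
    ∀ n : ℕ, 1 ≤ n → ∀ r : ℤ, u n ≤ r → r ≤ v n →
      (gam q ℓ n r : ℤ) = ⌈(q : ℚ) / ((ℓ : ℚ) + 1)⌉ ^ (n - 1) := by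
  have hm : 0 < ℓ + 1 := by omega
  have hmQ : (0 : ℚ) < (ℓ : ℚ) + 1 := by exact_mod_cast hm
  have hgam (n : ℕ) (r : ℤ) : gam q ℓ n r = (wordsOfWeight q (ℓ + 1) n
      ((q - 1) / 2 * (∑ i ∈ Finset.range n, (ℓ + 1) ^ i) + r)).ncard := rfl
  generalize (q - 1) / 2 = α at *
  intro n hn
  induction n, hn using Nat.le_induction with
  | base =>
    intro r hr0 hr1
    rw [hgam, ncard_wordsOfWeight_one] <;> simp <;> omega
  | succ n hn ih =>
    intro r hr0 hr1
    have h2 := h2 (n + 1) (by omega)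
    have h3 := h3 (n + 1) (by omega)
    rw [Nat.add_sub_cancel] at h2 h3
    have hS : α * (∑ i ∈ Finset.range (n + 1), (ℓ + 1) ^ i) + r =
        α + r + (ℓ + 1) * (α * ∑ i ∈ Finset.range n, (ℓ + 1) ^ i) := by
      rw [Finset.sum_range_succ']
      simp only [pow_succ', ← Finset.mul_sum]
      ring
    have hcard := card_filter_dvd_sub (q := q) (m := ℓ + 1)
      (s := α * (∑ i ∈ Finset.range (n + 1), (ℓ + 1) ^ i) + r) (by omega) hm
      ((h4 (n + 1) (by omega)).imp_right fun h => by
        rw [hS, Int.add_mul_emod_self_left]; exact h r hr0 hr1)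
    push_cast at hcard
    have hpow : ((⌈(q : ℚ) / ((ℓ : ℚ) + 1)⌉.toNat ^ (n - 1) : ℕ) : ℤ) =
        ⌈(q : ℚ) / ((ℓ : ℚ) + 1)⌉ ^ (n - 1) := by
      rw [Nat.cast_pow, Int.toNat_of_nonneg (hcard ▸ Int.natCast_nonneg _)]
    rw [hgam, ncard_wordsOfWeight_succ hm (c := ⌈(q : ℚ) / ((ℓ : ℚ) + 1)⌉.toNat ^ (n - 1)),
      Nat.cast_mul, hcard, hpow, ← pow_succ']
    · congr 1
      omega
    · intro a t ha0 ha1 hat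
      rw [hS] at hat
      have hr : (ℓ + 1) * (t - α * ∑ i ∈ Finset.range n, (ℓ + 1) ^ i) = α + r - a := by
        linarith
      have key := ih (t - α * ∑ i ∈ Finset.range n, (ℓ + 1) ^ i)
        (h2.trans ?_) (le_trans ?_ h3)
      · rw [hgam, add_sub_cancel, ← hpow] at key
        exact_mod_cast key
      · rw [Int.ceil_le, div_le_iff₀ hmQ]
        exact_mod_cast (by linarith :
          u (n + 1) + α - (q - 1) ≤ (t - α * ∑ i ∈ Finset.range n, (ℓ + 1) ^ i) * (ℓ + 1))
      · rw [Int.le_floor, le_div_iff₀ hmQ]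
        exact_mod_cast (by linarith :
          (t - α * ∑ i ∈ Finset.range n, (ℓ + 1) ^ i) * (ℓ + 1) ≤ v (n + 1) + α)
end
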